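/- arXiv:1107.4137 — 2 statements merged into one kernel-verified Lean document; each statement's English description precedes it below -/
import Mathlib

section
/- Let l = 5, let r be 1 or 2, and set a = [r], b = [2r]. Then p_{8,4}(1/a) + (p_{2,1}(1/b))^4 = a^4 + b^16. -/
open scoped Classical

/-- The theta series `[i]` for modulus `l`: `∑ x^(n²)` over integers `n ≡ i (mod l)`,
viewed in `ℤ/2[[x]]` (the coefficient of `x^k` is the mod-2 count of such `n` with `n² = k`). -/
noncomputable def theta (l i : ℤ) : PowerSeries (ZMod 2) :=
  PowerSeries.mk fun k => (({n : ℤ | n ≡ i [ZMOD l] ∧ n ^ 2 = (k : ℤ)}.ncard : ℕ) : ZMod 2)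

/-- The theta series viewed in the Laurent series field `L = ℤ/2((x))`. -/
noncomputable def thetaL (l i : ℤ) : LaurentSeries (ZMod 2) := (theta l i : LaurentSeries (ZMod 2))

/-- The projection `p_{q,j}` keeping only the coefficients in degrees `≡ j (mod q)`. -/
noncomputable def proj (q j : ℤ) (f : LaurentSeries (ZMod 2)) : LaurentSeries (ZMod 2) where
  coeff n := if n ≡ j [ZMOD q] then f.coeff n else 0
  isPWO_support' := f.isPWO_support'.mono (fun n hn => by
    simp only [Function.mem_support, ne_eq] at hn ⊢
    intro h; apply hn; split_ifs <;> simp [h])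

/-- `B(g)`: the set of integers `n` such that the coefficient of `x^n` in `1/g` is `1`. -/
noncomputable def Bset (g : PowerSeries (ZMod 2)) : Set ℤ :=
  {n : ℤ | ((g : LaurentSeries (ZMod 2))⁻¹).coeff n = 1}

/-- The subring `S` of `L` generated over `ℤ/2` by `[1], …, [m]`. -/
noncomputable def Sring (l : ℤ) (m : ℕ) : Subring (LaurentSeries (ZMod 2)) :=
  Subring.closure {x | ∃ i : ℕ, 1 ≤ i ∧ i ≤ m ∧ x = thetaL l i}

/-- The subring `S` of `ℤ/2[[x]]` generated over `ℤ/2` by `[1], …, [m]`. -/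
noncomputable def SringPS (l : ℤ) (m : ℕ) : Subring (PowerSeries (ZMod 2)) :=
  Subring.closure {x | ∃ i : ℕ, 1 ≤ i ∧ i ≤ m ∧ x = theta l i}

/-- The series `∑ x^(f s)` over `s ∈ S`, with coefficients reduced mod 2. -/
noncomputable def weightSeries {α : Type*} (S : Set α) (f : α → ℕ) : PowerSeries (ZMod 2) :=
  PowerSeries.mk fun k => (({s | s ∈ S ∧ f s = k}.ncard : ℕ) : ZMod 2)

theorem weightSeries_union {α : Type*} {S T : Set α} (h : Disjoint S T) {f : α → ℕ}
    (hf : ∀ k, {s | f s = k}.Finite) :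
    weightSeries (S ∪ T) f = weightSeries S f + weightSeries T f := by
  ext k
  have hST : {s | s ∈ S ∪ T ∧ f s = k} = {s | s ∈ S ∧ f s = k} ∪ {s | s ∈ T ∧ f s = k} := by
    ext s; simp only [Set.mem_union, Set.mem_ofPred_eq]; tauto
  simp only [weightSeries, PowerSeries.coeff_mk, map_add]
  rw [hST, Set.ncard_union_eq
    (h.mono (fun _ hs => hs.1) (fun _ hs => hs.1))
    ((hf k).subset fun _ hs => hs.2) ((hf k).subset fun _ hs => hs.2), Nat.cast_add]

theorem weightSeries_image {α β : Type*} {φ : β → α} (hφ : φ.Injective) (T : Set β) (f : α → ℕ) :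
    weightSeries (φ '' T) f = weightSeries T (f ∘ φ) := by
  ext k
  have : {s | s ∈ φ '' T ∧ f s = k} = φ '' {t | t ∈ T ∧ (f ∘ φ) t = k} := by
    ext s
    constructor
    · rintro ⟨⟨t, ht, rfl⟩, hk⟩
      exact ⟨t, ⟨ht, hk⟩, rfl⟩
    · rintro ⟨t, ⟨ht, hk⟩, rfl⟩
      exact ⟨⟨t, ht, rfl⟩, hk⟩
  simp only [weightSeries, PowerSeries.coeff_mk]
  rw [this, Set.ncard_image_of_injective _ hφ]

theorem PowerSeries.expand_two_eq_sq (f : PowerSeries (ZMod 2)) :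
    PowerSeries.expand 2 two_ne_zero f = f ^ 2 := by
  have h := MvPowerSeries.map_frobenius_expand 2 two_ne_zero (f := f)
  rwa [ZMod.frobenius_zmod, MvPowerSeries.map_id] at h

theorem weightSeries_two_mul {α : Type*} (S : Set α) (f : α → ℕ) :
    weightSeries S (fun s => 2 * f s) = weightSeries S f ^ 2 := by
  rw [← PowerSeries.expand_two_eq_sq]
  ext k
  rw [PowerSeries.coeff_expand]
  simp only [weightSeries, PowerSeries.coeff_mk]
  split_ifs with hk
  · obtain ⟨m, rfl⟩ := hk
    simp
  · have : {s | s ∈ S ∧ 2 * f s = k} = ∅ := by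
      ext s
      simp only [Set.mem_ofPred_eq, Set.mem_empty_iff_false, iff_false]
      rintro ⟨-, rfl⟩
      exact hk ⟨_, rfl⟩
    simp [this]

theorem weightSeries_mul {α β : Type*} (S : Set α) (T : Set β) {f : α → ℕ} {g : β → ℕ}
    (hf : ∀ k, {s | f s = k}.Finite) (hg : ∀ k, {s | g s = k}.Finite) :
    weightSeries S f * weightSeries T g =
      weightSeries (S ×ˢ T) (fun p => f p.1 + g p.2) := by
  ext k
  have hST : {p : α × β | p ∈ S ×ˢ T ∧ f p.1 + g p.2 = k} =
      ⋃ i ∈ (Finset.HasAntidiagonal.antidiagonal k : Set (ℕ × ℕ)),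
        {s | s ∈ S ∧ f s = i.1} ×ˢ {t | t ∈ T ∧ g t = i.2} := by
    ext ⟨s, t⟩
    simp only [Set.mem_ofPred_eq, Set.mem_prod, Set.mem_iUnion, Finset.mem_coe,
      Finset.HasAntidiagonal.mem_antidiagonal, exists_prop, Prod.exists]
    constructor
    · rintro ⟨⟨hs, ht⟩, h⟩
      exact ⟨_, _, h, ⟨hs, rfl⟩, ht, rfl⟩
    · rintro ⟨_, _, h, ⟨hs, rfl⟩, ht, rfl⟩
      exact ⟨⟨hs, ht⟩, h⟩
  simp only [weightSeries, PowerSeries.coeff_mk, PowerSeries.coeff_mul]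
  rw [hST, Set.Finite.ncard_biUnion (Finset.finite_toSet _), finsum_mem_coe_finset]
  · simp [Set.ncard_prod]
  · intro i _
    exact ((hf i.1).subset fun _ hs => hs.2).prod ((hg i.2).subset fun _ hs => hs.2)
  · intro i _ j _ hij
    refine Set.disjoint_left.2 ?_
    rintro ⟨s, t⟩ ⟨⟨-, h1⟩, -, h2⟩ ⟨⟨-, h3⟩, -, h4⟩
    exact hij (Prod.ext (h1.symm.trans h3) (h2.symm.trans h4))

theorem Int.finite_natAbs_sq_eq (k : ℕ) : {n : ℤ | n.natAbs ^ 2 = k}.Finite := by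
  refine (Set.finite_Icc (-(k : ℤ)) k).subset fun n hn => ?_
  have : n.natAbs ≤ k := by
    have h : n.natAbs ^ 2 = k := hn
    nlinarith
  exact Set.mem_Icc.2 (by omega)

theorem Int.finite_natAbs_sq_add_eq (k : ℕ) :
    {p : ℤ × ℤ | p.1.natAbs ^ 2 + p.2.natAbs ^ 2 = k}.Finite := by
  refine ((Set.finite_Icc (-(k : ℤ)) k).prod (Set.finite_Icc (-(k : ℤ)) k)).subset
    fun p hp => ?_
  have h : p.1.natAbs ^ 2 + p.2.natAbs ^ 2 = k := hp
  have h1 : p.1.natAbs ≤ k := by nlinarith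
  have h2 : p.2.natAbs ≤ k := by nlinarith
  exact ⟨Set.mem_Icc.2 (by omega), Set.mem_Icc.2 (by omega)⟩

theorem theta_eq_weightSeries (l i : ℤ) :
    theta l i = weightSeries {n | n ≡ i [ZMOD l]} (fun n => n.natAbs ^ 2) := by
  ext k
  simp only [theta, weightSeries, PowerSeries.coeff_mk, Set.mem_ofPred_eq]
  congr 3
  ext n
  rw [← Int.natAbs_sq, ← Nat.cast_pow, Nat.cast_inj]

/-- The part of `theta 5 i` coming from odd integers. -/
noncomputable def oddTheta (i : ℤ) : PowerSeries (ZMod 2) :=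
  weightSeries {n : ℤ | n ≡ i [ZMOD 5] ∧ Odd n} (fun n => n.natAbs ^ 2)

theorem weightSeries_even_sq {i j : ℤ} (h : i ≡ 2 * j [ZMOD 5]) :
    weightSeries {n : ℤ | n ≡ i [ZMOD 5] ∧ Even n} (fun n => n.natAbs ^ 2) = theta 5 j ^ 4 := by
  have hS : {n : ℤ | n ≡ i [ZMOD 5] ∧ Even n} =
      (fun n : ℤ => 2 * n) '' {n | n ≡ j [ZMOD 5]} := by
    ext n
    simp only [Set.mem_ofPred_eq, Set.mem_image, Int.ModEq] at h ⊢
    constructor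
    · rintro ⟨h1, m, rfl⟩
      exact ⟨m, by omega, by ring⟩
    · rintro ⟨m, h1, rfl⟩
      exact ⟨by omega, m, by ring⟩
  rw [hS, weightSeries_image (fun a b hab => by simpa using hab), theta_eq_weightSeries,
    show 4 = 2 * 2 from rfl, pow_mul, ← weightSeries_two_mul, ← weightSeries_two_mul]
  congr 1
  ext n
  simp only [Function.comp, Int.natAbs_mul]
  norm_num
  ring

theorem theta_neg (l i : ℤ) : theta l (-i) = theta l i := by
  have hS : {n : ℤ | n ≡ -i [ZMOD l]} = (fun n : ℤ => -n) '' {n | n ≡ i [ZMOD l]} := by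
    ext n
    simp only [Set.mem_ofPred_eq, Set.mem_image]
    exact ⟨fun h => ⟨-n, by simpa using h.neg, by simp⟩, by rintro ⟨m, h, rfl⟩; exact h.neg⟩
  rw [theta_eq_weightSeries, hS, weightSeries_image neg_injective, theta_eq_weightSeries]
  congr 1
  ext n
  simp

theorem theta_five_eq_add {i j : ℤ} (h : i ≡ 2 * j [ZMOD 5]) :
    theta 5 i = theta 5 j ^ 4 + oddTheta i := by
  rw [← weightSeries_even_sq h, oddTheta, ← weightSeries_union _ Int.finite_natAbs_sq_eq,
    theta_eq_weightSeries]
  · congr 1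
    ext n
    simp only [Set.mem_union, Set.mem_ofPred_eq, ← and_or_left, Int.even_or_odd, and_true]
  · refine Set.disjoint_left.2 fun n h1 h2 => ?_
    exact Int.not_odd_iff_even.2 h1.2 h2.2

theorem theta_five_eq_theta_two_mul_pow_add (r : ℤ) :
    theta 5 r = theta 5 (2 * r) ^ 4 + oddTheta r := by
  rw [← theta_neg 5 (2 * r)]
  exact theta_five_eq_add (by simp only [Int.ModEq]; omega)

theorem theta_five_two_mul_eq_theta_pow_add (r : ℤ) :
    theta 5 (2 * r) = theta 5 r ^ 4 + oddTheta (2 * r) :=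
  theta_five_eq_add rfl

theorem oddTheta_mul_oddTheta (r : ℤ) :
    oddTheta r * oddTheta (2 * r) =
      (oddTheta r * theta 5 r ^ 4 + theta 5 (2 * r) ^ 4 * oddTheta (2 * r)) ^ 2 := by
  have hr : r ≡ 2 * -(2 * r) [ZMOD 5] := by simp only [Int.ModEq]; omega
  rw [← weightSeries_even_sq (Int.ModEq.refl (2 * r)), ← theta_neg 5 (2 * r),
    ← weightSeries_even_sq hr]
  simp only [oddTheta]
  rw [weightSeries_mul _ _ Int.finite_natAbs_sq_eq Int.finite_natAbs_sq_eq,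
    weightSeries_mul _ _ Int.finite_natAbs_sq_eq Int.finite_natAbs_sq_eq,
    weightSeries_mul _ _ Int.finite_natAbs_sq_eq Int.finite_natAbs_sq_eq,
    ← weightSeries_union _ Int.finite_natAbs_sq_add_eq, ← weightSeries_two_mul]
  · have hinj : Function.Injective fun p : ℤ × ℤ => (p.2 - p.1, -(p.1 + p.2)) := by
      rintro ⟨a, b⟩ ⟨c, d⟩ h
      simp only [Prod.mk.injEq] at h ⊢
      omega
    rw [show (fun p : ℤ × ℤ => 2 * (p.1.natAbs ^ 2 + p.2.natAbs ^ 2)) =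
      (fun p : ℤ × ℤ => p.1.natAbs ^ 2 + p.2.natAbs ^ 2) ∘
        fun p : ℤ × ℤ => (p.2 - p.1, -(p.1 + p.2)) by
        ext p
        zify
        simp only [Function.comp, Nat.cast_add, Nat.cast_pow, Int.natCast_natAbs, sq_abs]
        ring, ← weightSeries_image hinj]
    congr 1
    ext ⟨m, n⟩
    simp only [Set.mem_prod, Set.mem_ofPred_eq, Set.mem_image, Set.mem_union, Prod.exists,
      Prod.mk.injEq, Int.ModEq, Int.odd_iff, Int.even_iff]
    constructor
    · rintro ⟨⟨h1, h2⟩, h3, h4⟩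
      obtain ⟨t, ht⟩ : (2 : ℤ) ∣ m - n := by omega
      obtain rfl : m = n + 2 * t := by omega
      have hs : (-(n + t)) % 5 = r % 5 := by omega
      have ht : t % 5 = 2 * r % 5 := by omega
      refine ⟨-(n + t), t, ?_, by ring, by ring⟩
      rcases Int.emod_two_eq_zero_or_one t with h0 | h0
      · exact Or.inl ⟨⟨hs, by omega⟩, ht, h0⟩
      · exact Or.inr ⟨⟨hs, by omega⟩, ht, h0⟩
    · rintro ⟨s, t, ⟨⟨h1, h2⟩, h3, h4⟩ | ⟨⟨h1, h2⟩, h3, h4⟩, rfl, rfl⟩ <;>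
        exact ⟨⟨by omega, by omega⟩, by omega, by omega⟩
  · refine Set.disjoint_left.2 fun p h1 h2 => ?_
    exact Int.not_odd_iff_even.2 h2.1.2 h1.1.2

theorem PowerSeries.two_eq_zero : (2 : PowerSeries (ZMod 2)) = 0 := by
  rw [← map_ofNat (PowerSeries.C (R := ZMod 2)) 2, show (OfNat.ofNat 2 : ZMod 2) = 0 from rfl,
    map_zero]

theorem constantCoeff_theta_five {r : ℤ} (hr : ¬ (5 : ℤ) ∣ r) :
    PowerSeries.constantCoeff (theta 5 r) = 0 := by
  have : {n : ℤ | n ≡ r [ZMOD 5] ∧ n ^ 2 = ((0 : ℕ) : ℤ)} = ∅ := by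
    ext n
    simp only [Set.mem_ofPred_eq, Set.mem_empty_iff_false, iff_false, Int.ModEq]
    rintro ⟨h, h0⟩
    have : n = 0 := by simpa using h0
    omega
  rw [← PowerSeries.coeff_zero_eq_constantCoeff_apply, theta, PowerSeries.coeff_mk, this]
  simp

/-- The quintic relation between the two theta series of modulus `5`. -/
theorem theta_five_quintic {r : ℤ} (hr : ¬ (5 : ℤ) ∣ r) :
    theta 5 r ^ 5 + theta 5 (2 * r) ^ 5 + theta 5 r ^ 2 * theta 5 (2 * r) ^ 2
      + theta 5 r * theta 5 (2 * r) = 0 := by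
  have ha := theta_five_eq_theta_two_mul_pow_add r
  have hb := theta_five_two_mul_eq_theta_pow_add r
  have hAB := oddTheta_mul_oddTheta r
  have h2 := PowerSeries.two_eq_zero
  have hca := constantCoeff_theta_five hr
  have hcb : PowerSeries.constantCoeff (theta 5 (2 * r)) = 0 :=
    constantCoeff_theta_five (by omega)
  generalize theta 5 r = a at *
  generalize theta 5 (2 * r) = b at *
  have hA : oddTheta r = a + b ^ 4 := by linear_combination -ha - b ^ 4 * h2
  have hB : oddTheta (2 * r) = b + a ^ 4 := by linear_combination -hb - a ^ 4 * h2
  rw [hA, hB] at hAB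
  have hidem : IsIdempotentElem (a ^ 5 + b ^ 5 + a ^ 2 * b ^ 2 + a * b) := by
    unfold IsIdempotentElem
    linear_combination -hAB + h2 * ((a ^ 5 + b ^ 5) * (a ^ 2 * b ^ 2 + a * b) + a ^ 3 * b ^ 3
      + a ^ 4 * b ^ 4 - 2 * (a ^ 5 + b ^ 5) * a ^ 4 * b ^ 4 - 2 * a ^ 8 * b ^ 8)
  refine (IsIdempotentElem.iff_eq_zero_or_one.1 hidem).resolve_right fun h1 => ?_
  simpa [hca, hcb] using congrArg PowerSeries.constantCoeff h1
/-- The series `f` involves only exponents `≡ j (mod q)`. -/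
def SupportedModEq (q j : ℤ) (f : LaurentSeries (ZMod 2)) : Prop :=
  ∀ n, f.coeff n ≠ 0 → n ≡ j [ZMOD q]

namespace SupportedModEq

variable {q i j : ℤ} {f g : LaurentSeries (ZMod 2)}

theorem add (hf : SupportedModEq q j f) (hg : SupportedModEq q j g) :
    SupportedModEq q j (f + g) := fun n hn => by
  by_cases h : f.coeff n = 0
  · exact hg n fun h' => hn (by simp [h, h'])
  · exact hf n h

theorem mul (hf : SupportedModEq q i f) (hg : SupportedModEq q j g) :
    SupportedModEq q (i + j) (f * g) := fun n hn => by
  obtain ⟨k, hk, m, hm, rfl⟩ := HahnSeries.support_mul_subset hn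
  exact (hf k hk).add (hg m hm)

theorem congr (hf : SupportedModEq q i f) (h : i ≡ j [ZMOD q]) : SupportedModEq q j f :=
  fun n hn => (hf n hn).trans h

theorem of_dvd {q' : ℤ} (hf : SupportedModEq q' j f) (h : q ∣ q') : SupportedModEq q j f :=
  fun n hn => (hf n hn).of_dvd h

theorem proj_eq_self (hf : SupportedModEq q j f) : proj q j f = f := by
  ext n
  simp only [proj]
  split_ifs with h
  · rfl
  · by_contra h'
    exact h (hf n (Ne.symm h'))

theorem proj_eq_zero (hf : SupportedModEq q i f) (h : ¬ i ≡ j [ZMOD q]) : proj q j f = 0 := by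
  ext n
  simp only [proj, HahnSeries.coeff_zero]
  split_ifs with hn
  · by_contra h'
    exact h ((hf n h').symm.trans hn)
  · rfl

end SupportedModEq

theorem supportedModEq_proj (q j : ℤ) (f : LaurentSeries (ZMod 2)) :
    SupportedModEq q j (proj q j f) := fun n hn => by
  simp only [proj] at hn
  by_contra h
  simp [h] at hn

theorem proj_add (q j : ℤ) (f g : LaurentSeries (ZMod 2)) :
    proj q j (f + g) = proj q j f + proj q j g := by
  ext n
  simp only [proj, HahnSeries.coeff_add]
  split_ifs <;> simp

theorem LaurentSeries.two_eq_zero : (2 : LaurentSeries (ZMod 2)) = 0 := by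
  rw [← map_ofNat (HahnSeries.C (Γ := ℤ) (R := ZMod 2)) 2,
    show (OfNat.ofNat 2 : ZMod 2) = 0 from rfl, map_zero]

theorem SupportedModEq.sq {q j : ℤ} {f : LaurentSeries (ZMod 2)} (hf : SupportedModEq q j f) :
    SupportedModEq (2 * q) (2 * j) (f ^ 2) := by
  have h1 := supportedModEq_proj (2 * q) j f
  have h2 : SupportedModEq (2 * q) (j + q) (f - proj (2 * q) j f) := fun n hn => by
    simp only [proj, HahnSeries.coeff_sub] at hn
    by_cases hnj : n ≡ j [ZMOD 2 * q]
    · simp [hnj] at hn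
    · simp only [hnj, if_false, sub_zero] at hn
      obtain ⟨k, hk⟩ := (hf n hn).dvd
      rcases Int.even_or_odd' k with ⟨m, rfl | rfl⟩
      · exact absurd (Int.modEq_iff_dvd.2 ⟨m, by rw [hk]; ring⟩) hnj
      · exact Int.modEq_iff_dvd.2 ⟨m + 1, by linear_combination hk⟩
  have hsplit : f = proj (2 * q) j f + (f - proj (2 * q) j f) := by ring
  generalize f - proj (2 * q) j f = v at *
  generalize proj (2 * q) j f = u at *
  have hsq : f ^ 2 = u * u + v * v := by
    rw [hsplit]
    linear_combination u * v * LaurentSeries.two_eq_zero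
  rw [hsq]
  exact ((h1.mul h1).congr (by rw [two_mul j])).add
    ((h2.mul h2).congr (by rw [Int.modEq_iff_dvd]; exact ⟨-1, by ring⟩))

theorem supportedModEq_pow_eight (f : LaurentSeries (ZMod 2)) : SupportedModEq 8 0 (f ^ 8) := by
  have h : SupportedModEq 1 0 f := fun n _ => Int.modEq_one
  simpa [← pow_mul] using h.sq.sq.sq

theorem supportedModEq_oddTheta (i : ℤ) :
    SupportedModEq 8 1 (oddTheta i : LaurentSeries (ZMod 2)) := fun n hn => by
  rw [PowerSeries.coeff_coe] at hn
  split_ifs at hn with h0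
  · simp at hn
  · have hne : {m : ℤ | m ∈ {m : ℤ | m ≡ i [ZMOD 5] ∧ Odd m} ∧
        m.natAbs ^ 2 = n.natAbs}.Nonempty := by
      by_contra h
      rw [Set.not_nonempty_iff_eq_empty] at h
      exact hn (by simp only [oddTheta, weightSeries, PowerSeries.coeff_mk, h]; simp)
    obtain ⟨m, ⟨-, hm⟩, hmn⟩ := hne
    have : n = m ^ 2 := by
      zify at hmn
      rw [sq_abs, abs_of_nonneg (not_lt.1 h0)] at hmn
      exact hmn.symm
    rw [this]
    exact (Int.modEq_iff_dvd.2 (Int.eight_dvd_sq_sub_one_of_odd hm)).symm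

theorem proj_two_one_inv {a b B : LaurentSeries (ZMod 2)} (hb0 : b ≠ 0) (hb : b = a ^ 4 + B)
    (hB : SupportedModEq 2 1 B) : proj 2 1 b⁻¹ = B / b ^ 2 := by
  have hsq (f : LaurentSeries (ZMod 2)) : SupportedModEq 2 0 (f ^ 2) :=
    (show SupportedModEq 1 0 f from fun n _ => Int.modEq_one).sq
  have h : b⁻¹ = (a ^ 2 * b⁻¹) ^ 2 + B * b⁻¹ ^ 2 := by
    field_simp
    exact hb
  rw [h, proj_add, (hsq _).proj_eq_zero (by decide), ((hB.mul (hsq _)).congr (j := 1) rfl).proj_eq_self, zero_add,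
    div_eq_mul_inv, inv_pow]

theorem proj_eight_four_inv {a c D A : LaurentSeries (ZMod 2)} (ha0 : a ≠ 0)
    (ha : a = c + D + A) (hc : SupportedModEq 8 0 c) (hD : SupportedModEq 8 4 D)
    (hA : SupportedModEq 8 1 A) :
    proj 8 4 a⁻¹ = (D * (c + D) ^ 6 + c * (c + D) ^ 2 * A ^ 4) / a ^ 8 := by
  have h2 := LaurentSeries.two_eq_zero
  have he : SupportedModEq 8 0 ((c + D) ^ 2) := by
    have h4 : SupportedModEq 4 0 (c + D) :=
      (hc.of_dvd (by norm_num)).add ((hD.of_dvd (by norm_num)).congr (by decide))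
    exact h4.sq
  have hi := supportedModEq_pow_eight a⁻¹
  have hA2 : SupportedModEq 8 2 (A ^ 2) := hA.sq.of_dvd (by norm_num)
  have hA4 : SupportedModEq 8 4 ((A ^ 2) ^ 2) := hA2.sq.of_dvd (by norm_num)
  have he4 : SupportedModEq 8 0 (((c + D) ^ 2) ^ 2) := he.sq.of_dvd (by norm_num)
  have h : a⁻¹ =
      (D * ((c + D) ^ 2 * ((c + D) ^ 2) ^ 2) + c * ((c + D) ^ 2 * (A ^ 2) ^ 2)) * a⁻¹ ^ 8
      + c * ((c + D) ^ 2 * ((c + D) ^ 2) ^ 2) * a⁻¹ ^ 8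
      + D * ((c + D) ^ 2 * (A ^ 2) ^ 2) * a⁻¹ ^ 8
      + c * (A ^ 2 * ((c + D) ^ 2) ^ 2) * a⁻¹ ^ 8
      + D * (A ^ 2 * ((c + D) ^ 2) ^ 2) * a⁻¹ ^ 8
      + c * (A ^ 2 * (A ^ 2) ^ 2) * a⁻¹ ^ 8
      + D * (A ^ 2 * (A ^ 2) ^ 2) * a⁻¹ ^ 8
      + A * ((c + D) ^ 2 * ((c + D) ^ 2) ^ 2) * a⁻¹ ^ 8
      + A * ((c + D) ^ 2 * (A ^ 2) ^ 2) * a⁻¹ ^ 8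
      + A * (A ^ 2 * ((c + D) ^ 2) ^ 2) * a⁻¹ ^ 8
      + A * (A ^ 2 * (A ^ 2) ^ 2) * a⁻¹ ^ 8 := by
    have hsq : a ^ 2 = (c + D) ^ 2 + A ^ 2 := by
      rw [ha]
      linear_combination (c + D) * A * h2
    have hfour : a ^ 4 = ((c + D) ^ 2) ^ 2 + (A ^ 2) ^ 2 := by
      linear_combination (a ^ 2 + (c + D) ^ 2 + A ^ 2) * hsq + (c + D) ^ 2 * A ^ 2 * h2
    have hseven : a⁻¹ = a * (a ^ 2 * a ^ 4) * a⁻¹ ^ 8 := by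
      field_simp
    rw [hsq, hfour] at hseven
    linear_combination hseven
      + ((c + D) ^ 2 + A ^ 2) * (((c + D) ^ 2) ^ 2 + (A ^ 2) ^ 2) * a⁻¹ ^ 8 * ha
  have key : proj 8 4 a⁻¹ =
      (D * ((c + D) ^ 2 * ((c + D) ^ 2) ^ 2) + c * ((c + D) ^ 2 * (A ^ 2) ^ 2)) * a⁻¹ ^ 8 := by
    conv_lhs => rw [h]
    simp only [proj_add]
    rw [((((hD.mul (he.mul he4)).congr (j := 4) rfl).add
        ((hc.mul (he.mul hA4)).congr rfl)).mul hi).congr (j := 4) rfl |>.proj_eq_self,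
      ((hc.mul (he.mul he4)).mul hi).proj_eq_zero (by decide),
      ((hD.mul (he.mul hA4)).mul hi).proj_eq_zero (by decide),
      ((hc.mul (hA2.mul he4)).mul hi).proj_eq_zero (by decide),
      ((hD.mul (hA2.mul he4)).mul hi).proj_eq_zero (by decide),
      ((hc.mul (hA2.mul hA4)).mul hi).proj_eq_zero (by decide),
      ((hD.mul (hA2.mul hA4)).mul hi).proj_eq_zero (by decide),
      ((hA.mul (he.mul he4)).mul hi).proj_eq_zero (by decide),
      ((hA.mul (he.mul hA4)).mul hi).proj_eq_zero (by decide),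
      ((hA.mul (hA2.mul he4)).mul hi).proj_eq_zero (by decide),
      ((hA.mul (hA2.mul hA4)).mul hi).proj_eq_zero (by decide)]
    simp only [add_zero]
  rw [key, div_eq_mul_inv, inv_pow]
  ring

theorem thetaL_five_ne_zero {r : ℤ} (hr : ¬ (5 : ℤ) ∣ r) : thetaL 5 r ≠ 0 := by
  intro h
  have hcoeff : (thetaL 5 r).coeff ((r.natAbs ^ 2 : ℕ) : ℤ) = 1 := by
    rw [thetaL, LaurentSeries.coeff_coe_powerSeries, theta, PowerSeries.coeff_mk]
    have : {n : ℤ | n ≡ r [ZMOD 5] ∧ n ^ 2 = ((r.natAbs ^ 2 : ℕ) : ℤ)} = {r} := by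
      ext n
      simp only [Set.mem_ofPred_eq, Set.mem_singleton_iff, Nat.cast_pow, Int.natAbs_sq]
      constructor
      · rintro ⟨h1, h2⟩
        rcases sq_eq_sq_iff_eq_or_eq_neg.1 h2 with rfl | rfl
        · rfl
        · simp only [Int.ModEq] at h1
          omega
      · rintro rfl
        exact ⟨rfl, rfl⟩
    rw [this]
    simp
  rw [h] at hcoeff
  simp at hcoeff

theorem stmt17 (r : ℤ) (hr : r = 1 ∨ r = 2) :
    proj 8 4 (thetaL 5 r)⁻¹ + (proj 2 1 (thetaL 5 (2 * r))⁻¹) ^ 4 =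
      thetaL 5 r ^ 4 + thetaL 5 (2 * r) ^ 16 := by
  have hr5 : ¬ (5 : ℤ) ∣ r := by omega
  have ha0 := thetaL_five_ne_zero hr5
  have hb0 : thetaL 5 (2 * r) ≠ 0 := thetaL_five_ne_zero (by omega)
  have hA := supportedModEq_oddTheta r
  have hB := supportedModEq_oddTheta (2 * r)
  have ha := congrArg (HahnSeries.ofPowerSeries ℤ (ZMod 2))
    (theta_five_eq_theta_two_mul_pow_add r)
  have hb := congrArg (HahnSeries.ofPowerSeries ℤ (ZMod 2))
    (theta_five_two_mul_eq_theta_pow_add r)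
  have hP := congrArg (HahnSeries.ofPowerSeries ℤ (ZMod 2)) (theta_five_quintic hr5)
  have h2 := LaurentSeries.two_eq_zero
  simp only [map_add, map_mul, map_pow, map_zero] at ha hb hP
  simp only [thetaL] at *
  generalize HahnSeries.ofPowerSeries ℤ (ZMod 2) (theta 5 r) = a at *
  generalize HahnSeries.ofPowerSeries ℤ (ZMod 2) (theta 5 (2 * r)) = b at *
  generalize HahnSeries.ofPowerSeries ℤ (ZMod 2) (oddTheta r) = A at *
  generalize HahnSeries.ofPowerSeries ℤ (ZMod 2) (oddTheta (2 * r)) = B at *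
  have hb4 : b ^ 4 = a ^ 16 + B ^ 4 := by
    rw [hb]
    linear_combination (2 * a ^ 12 * B + 3 * a ^ 8 * B ^ 2 + 2 * a ^ 4 * B ^ 3) * h2
  have hD : SupportedModEq 8 4 (B ^ 4) := by
    have := hB.sq.sq.of_dvd (q := 8) (by norm_num)
    rwa [← pow_mul] at this
  have hc : SupportedModEq 8 0 (a ^ 16) := by
    have := supportedModEq_pow_eight (a ^ 2)
    rwa [← pow_mul] at this
  rw [proj_two_one_inv hb0 hb (hB.of_dvd (by norm_num)),
    proj_eight_four_inv ha0 (by rw [← hb4]; exact ha) hc hD hA, ← hb4]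
  have hA' : A = a + b ^ 4 := by linear_combination -ha - b ^ 4 * h2
  have hB' : B ^ 4 = b ^ 4 + a ^ 16 := by linear_combination -hb4 - a ^ 16 * h2
  have hA4 : A ^ 4 = a ^ 4 + b ^ 16 := by
    rw [hA']
    linear_combination (2 * a ^ 3 * b ^ 4 + 3 * a ^ 2 * b ^ 8 + 2 * a * b ^ 12) * h2
  have hP2 : a ^ 10 + b ^ 10 + a ^ 4 * b ^ 4 + a ^ 2 * b ^ 2 = 0 := by
    linear_combination (a ^ 5 + b ^ 5 + a ^ 2 * b ^ 2 + a * b) * hP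
      - ((a ^ 5 + b ^ 5) * (a ^ 2 * b ^ 2 + a * b) + a ^ 5 * b ^ 5 + a ^ 3 * b ^ 3) * h2
  have hP4 : a ^ 20 + b ^ 20 + a ^ 8 * b ^ 8 + a ^ 4 * b ^ 4 = 0 := by
    linear_combination (a ^ 10 + b ^ 10 + a ^ 4 * b ^ 4 + a ^ 2 * b ^ 2) * hP2
      - ((a ^ 10 + b ^ 10) * (a ^ 4 * b ^ 4 + a ^ 2 * b ^ 2) + a ^ 10 * b ^ 10
        + a ^ 6 * b ^ 6) * h2
  rw [div_pow, hA4, hB', ← pow_mul b 2 4, div_add_div _ _ (pow_ne_zero _ ha0) (pow_ne_zero _ hb0),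
    div_eq_iff (mul_ne_zero (pow_ne_zero _ ha0) (pow_ne_zero _ hb0))]
  linear_combination (a ^ 4 + b ^ 16) * hP4
    + (a ^ 16 * b ^ 32 - a ^ 12 * b ^ 8 - a ^ 8 * b ^ 24 - a ^ 4 * b ^ 20) * h2
end

section
/- Let l = 7, let r be 1, 2 or 3, and set a = [r], b = [4r], c = [2r]. Then p_{8,0}(1/a) = b^8·c^8 and p_{8,2}(1/a) = (a² + b^8)·c^8. -/
open scoped Classical

theorem PowerSeries.sq_eq_expand_zmod_two (f : PowerSeries (ZMod 2)) :
    f ^ 2 = f.expand 2 two_ne_zero := by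
  have h := MvPowerSeries.map_frobenius_expand 2 two_ne_zero (f := f)
  rw [ZMod.frobenius_zmod, MvPowerSeries.map_id] at h
  exact h.symm

/-- The generating series over `ℤ/2` counting the elements of `S` by the value of `Q`. -/
noncomputable def countSeries {α : Type*} (S : Set α) (Q : α → ℤ) : PowerSeries (ZMod 2) :=
  PowerSeries.mk fun k => (({s | s ∈ S ∧ Q s = (k : ℤ)}.ncard : ℕ) : ZMod 2)

namespace countSeries

variable {α β : Type*}

theorem eq_add_of_disjoint_union {S T U : Set α} {Q : α → ℤ} (hQ : ∀ k, {s | Q s = k}.Finite)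
    (hU : U = S ∪ T) (hST : Disjoint S T) :
    countSeries U Q = countSeries S Q + countSeries T Q := by
  subst hU
  ext k
  simp only [countSeries, PowerSeries.coeff_mk, map_add]
  rw [← Nat.cast_add, ← Set.ncard_union_eq (hST.mono (fun s hs => hs.1) (fun s hs => hs.1))
    ((hQ k).subset fun s hs => hs.2) ((hQ k).subset fun s hs => hs.2)]
  congr 2
  ext s
  simp only [Set.mem_union, Set.mem_ofPred_eq]
  tauto

theorem image {S : Set α} {T : Set β} {Q : α → ℤ} {R : β → ℤ} {f : α → β}
    (hf : f.Injective) (hT : T = f '' S) (hR : ∀ s, R (f s) = Q s) :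
    countSeries S Q = countSeries T R := by
  subst hT
  ext k
  simp only [countSeries, PowerSeries.coeff_mk]
  rw [← Set.ncard_image_of_injective _ hf]
  congr 2
  ext t
  constructor
  · rintro ⟨s, ⟨hs, hk⟩, rfl⟩
    exact ⟨⟨s, hs, rfl⟩, by rw [hR, hk]⟩
  · rintro ⟨⟨s, hs, rfl⟩, hk⟩
    exact ⟨s, ⟨hs, by rw [← hR, hk]⟩, rfl⟩

theorem mul {S : Set α} {T : Set β} {Q : α → ℤ} {R : β → ℤ}
    (hQ : ∀ k, {s | Q s = k}.Finite) (hR : ∀ k, {t | R t = k}.Finite)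
    (hQ0 : ∀ s, 0 ≤ Q s) (hR0 : ∀ t, 0 ≤ R t) :
    countSeries S Q * countSeries T R = countSeries (S ×ˢ T) fun p => Q p.1 + R p.2 := by
  ext k
  have key : {p : α × β | p ∈ S ×ˢ T ∧ Q p.1 + R p.2 = (k : ℤ)} =
      ⋃ ij ∈ (Finset.HasAntidiagonal.antidiagonal k : Set (ℕ × ℕ)),
        {s | s ∈ S ∧ Q s = (ij.1 : ℤ)} ×ˢ {t | t ∈ T ∧ R t = (ij.2 : ℤ)} := by
    ext ⟨s, t⟩
    simp only [Set.mem_ofPred_eq, Set.mem_prod, Set.mem_iUnion, Finset.mem_coe,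
      Finset.HasAntidiagonal.mem_antidiagonal, Prod.exists]
    constructor
    · rintro ⟨⟨hs, ht⟩, hk⟩
      have h1 := hQ0 s
      have h2 := hR0 t
      exact ⟨(Q s).toNat, (R t).toNat, by omega, ⟨hs, by omega⟩, ht, by omega⟩
    · rintro ⟨i, j, hij, ⟨hs, hi⟩, ht, hj⟩
      exact ⟨⟨hs, ht⟩, by omega⟩
  rw [PowerSeries.coeff_mul]
  simp only [countSeries, PowerSeries.coeff_mk]
  rw [key, Set.Finite.ncard_biUnion (Finset.finite_toSet _), finsum_mem_coe_finset]
  · simp only [Set.ncard_prod, Nat.cast_sum, Nat.cast_mul]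
  · exact fun ij _ => ((hQ _).subset fun s hs => hs.2).prod ((hR _).subset fun t ht => ht.2)
  · rintro ⟨i, j⟩ - ⟨i', j'⟩ - hne
    refine Set.disjoint_left.2 ?_
    rintro ⟨s, t⟩ ⟨⟨-, h1⟩, -, h2⟩ ⟨⟨-, h3⟩, -, h4⟩
    apply hne
    simp only at h1 h2 h3 h4
    ext <;> simp only <;> omega

theorem sq (S : Set α) (Q : α → ℤ) :
    countSeries S Q ^ 2 = countSeries S fun s => 2 * Q s := by
  ext k
  rw [PowerSeries.sq_eq_expand_zmod_two, PowerSeries.coeff_expand]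
  simp only [countSeries, PowerSeries.coeff_mk]
  split_ifs with h
  · obtain ⟨m, rfl⟩ := h
    congr 3
    ext s
    refine and_congr_right fun _ => ?_
    omega
  · have : {s | s ∈ S ∧ 2 * Q s = (k : ℤ)} = ∅ := by
      ext s
      simp only [Set.mem_ofPred_eq, Set.mem_empty_iff_false, iff_false, not_and]
      omega
    simp [this]

end countSeries

theorem finite_setOf_int_sq_eq (k : ℤ) : {n : ℤ | n ^ 2 = k}.Finite := by
  refine (Set.finite_Icc (-k) k).subset fun n (hn : n ^ 2 = k) => ?_
  constructor <;> nlinarith [Int.le_self_sq n, Int.le_self_sq (-n)]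

theorem finite_setOf_int_sq_add_sq_eq (k : ℤ) :
    {p : ℤ × ℤ | p.1 ^ 2 + p.2 ^ 2 = k}.Finite := by
  refine ((Set.finite_Icc (-k) k).prod (Set.finite_Icc (-k) k)).subset
    fun p (hp : p.1 ^ 2 + p.2 ^ 2 = k) => ?_
  have h1 := Int.le_self_sq p.1
  have h2 := Int.le_self_sq (-p.1)
  have h3 := Int.le_self_sq p.2
  have h4 := Int.le_self_sq (-p.2)
  refine ⟨⟨?_, ?_⟩, ?_, ?_⟩ <;> nlinarith [sq_nonneg p.1, sq_nonneg p.2]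

/-- The part of the theta series `[i]` for modulus `l` coming from odd `n`. -/
noncomputable def thetaOdd (l i : ℤ) : PowerSeries (ZMod 2) :=
  countSeries {n : ℤ | n ≡ i [ZMOD l] ∧ Odd n} fun n => n ^ 2

theorem theta_eq_countSeries (l i : ℤ) :
    theta l i = countSeries {n : ℤ | n ≡ i [ZMOD l]} fun n => n ^ 2 := rfl

theorem theta_pow_four {i j : ℤ} (h : 2 * j ≡ i [ZMOD 7]) :
    theta 7 j ^ 4 = countSeries {n : ℤ | n ≡ i [ZMOD 7] ∧ Even n} fun n => n ^ 2 := by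
  rw [show theta 7 j ^ 4 = (theta 7 j ^ 2) ^ 2 by ring, theta_eq_countSeries, countSeries.sq,
    countSeries.sq]
  refine countSeries.image (f := fun n : ℤ => 2 * n) (fun m n h => by simpa using h) ?_
    (fun n => by ring)
  ext n
  simp only [Set.mem_ofPred_eq, Set.mem_image, Int.ModEq, Int.even_iff] at h ⊢
  constructor
  · rintro ⟨h1, h2⟩
    exact ⟨n / 2, by omega, by omega⟩
  · rintro ⟨m, h1, rfl⟩
    omega

theorem theta_eq_pow_four_add_thetaOdd {i j : ℤ} (h : 2 * j ≡ i [ZMOD 7]) :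
    theta 7 i = theta 7 j ^ 4 + thetaOdd 7 i := by
  rw [theta_pow_four h, theta_eq_countSeries, thetaOdd]
  refine countSeries.eq_add_of_disjoint_union finite_setOf_int_sq_eq ?_ ?_
  · ext n
    have := Int.even_or_odd n
    simp only [Set.mem_ofPred_eq, Set.mem_union]
    tauto
  · refine Set.disjoint_left.2 fun n hn hn' => ?_
    exact Int.not_even_iff_odd.2 hn'.2 hn.2

theorem theta_sq_mul_theta_sq (r : ℤ) :
    theta 7 r ^ 2 * theta 7 (2 * r) ^ 2 =
      theta 7 (4 * r) ^ 4 * theta 7 (2 * r) ^ 4 + thetaOdd 7 r * thetaOdd 7 (4 * r) := by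
  rw [theta_pow_four (show 2 * (4 * r) ≡ r [ZMOD 7] by simp only [Int.ModEq]; omega),
    theta_pow_four (show 2 * (2 * r) ≡ 4 * r [ZMOD 7] by simp only [Int.ModEq]; omega),
    ← mul_pow, theta_eq_countSeries, theta_eq_countSeries, thetaOdd, thetaOdd]
  iterate 3
    rw [countSeries.mul finite_setOf_int_sq_eq finite_setOf_int_sq_eq sq_nonneg sq_nonneg]
  rw [countSeries.sq, ← countSeries.eq_add_of_disjoint_union finite_setOf_int_sq_add_sq_eq rfl]
  · refine countSeries.image (f := fun p : ℤ × ℤ => (p.2 - p.1, -(p.1 + p.2))) ?_ ?_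
      (fun p => by ring)
    · rintro ⟨m, n⟩ ⟨m', n'⟩ h
      simp only [Prod.mk.injEq] at h ⊢
      omega
    · ext ⟨x, y⟩
      simp only [Set.mem_union, Set.mem_prod, Set.mem_ofPred_eq, Set.mem_image, Prod.exists,
        Prod.mk.injEq, Int.ModEq, Int.even_iff, Int.odd_iff]
      constructor
      · intro h
        exact ⟨(-x - y) / 2, (x - y) / 2, by omega, by omega, by omega⟩
      · rintro ⟨m, n, h, rfl, rfl⟩
        omega
  · refine Set.disjoint_left.2 fun p hp hp' => ?_
    exact Int.not_even_iff_odd.2 hp'.1.2 hp.1.2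

/-- All exponents occurring in `f` are congruent to `j` modulo `q`. -/
def SupportedMod (q j : ℤ) (f : LaurentSeries (ZMod 2)) : Prop :=
  ∀ n, f.coeff n ≠ 0 → n ≡ j [ZMOD q]

namespace SupportedMod

variable {q i j : ℤ} {f g : LaurentSeries (ZMod 2)}

theorem mul (hf : SupportedMod q i f) (hg : SupportedMod q j g) :
    SupportedMod q (i + j) (f * g) := by
  intro n hn
  rw [HahnSeries.coeff_mul] at hn
  obtain ⟨p, hp, -⟩ := Finset.exists_ne_zero_of_sum_ne_zero hn
  rw [Finset.mem_antidiagonal] at hp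
  rw [← hp.2.2]
  exact (hf _ hp.1).add (hg _ hp.2.1)

theorem one : SupportedMod q 0 1 := by
  intro n hn
  rw [HahnSeries.coeff_one] at hn
  split_ifs at hn with h
  · rw [h]
  · exact absurd rfl hn

theorem pow (hf : SupportedMod q j f) (k : ℕ) : SupportedMod q (k * j) (f ^ k) := by
  induction k with
  | zero => simpa using one
  | succ k ih =>
    rw [pow_succ, Nat.cast_succ, add_mul, one_mul]
    exact ih.mul hf

theorem proj_eq_self (hf : SupportedMod q i f) (h : i ≡ j [ZMOD q]) : proj q j f = f := by
  ext n
  change (if n ≡ j [ZMOD q] then f.coeff n else 0) = f.coeff n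
  split_ifs with hn
  · rfl
  · by_contra h0
    exact hn ((hf n (Ne.symm h0)).trans h)

theorem proj_eq_zero (hf : SupportedMod q i f) (h : ¬ i ≡ j [ZMOD q]) : proj q j f = 0 := by
  ext n
  change (if n ≡ j [ZMOD q] then f.coeff n else 0) = 0
  split_ifs with hn
  · by_contra h0
    exact h ((hf n h0).symm.trans hn)
  · rfl

theorem coe_sq {f : PowerSeries (ZMod 2)} (hf : SupportedMod q j (f : LaurentSeries (ZMod 2))) :
    SupportedMod (2 * q) (2 * j) ((f ^ 2 : PowerSeries (ZMod 2)) : LaurentSeries (ZMod 2)) := by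
  intro n hn
  rw [PowerSeries.coeff_coe, PowerSeries.sq_eq_expand_zmod_two, PowerSeries.coeff_expand] at hn
  split_ifs at hn with h0 h2
  · exact absurd rfl hn
  · obtain ⟨m, hm⟩ := h2
    obtain rfl : n = 2 * (m : ℤ) := by omega
    refine Int.ModEq.mul_left' (hf m ?_)
    rw [PowerSeries.coeff_coe, if_neg (by omega)]
    rw [hm, Nat.mul_div_cancel_left _ two_pos] at hn
    simpa using hn
  · exact absurd rfl hn

theorem pow_eight (f : LaurentSeries (ZMod 2)) : SupportedMod 8 0 (f ^ 8) := by
  have h1 : SupportedMod 8 0 ((f.powerSeriesPart ^ 8 : PowerSeries (ZMod 2)) :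
      LaurentSeries (ZMod 2)) := by
    have h : SupportedMod 1 0 (f.powerSeriesPart : LaurentSeries (ZMod 2)) :=
      fun n _ => Int.modEq_one
    have := h.coe_sq.coe_sq.coe_sq
    rw [← pow_mul, ← pow_mul] at this
    simpa using this
  have h2 : SupportedMod 8 0 (HahnSeries.single f.order (1 : ZMod 2) ^ 8) := by
    intro n hn
    rw [HahnSeries.single_pow, HahnSeries.coeff_single] at hn
    split_ifs at hn with h
    · rw [h, nsmul_eq_mul, Int.modEq_zero_iff_dvd]
      exact dvd_mul_right _ _
    · exact absurd rfl hn
  rw [← LaurentSeries.single_order_mul_powerSeriesPart f, mul_pow, ← PowerSeries.coe_pow]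
  exact h2.mul h1

end SupportedMod

theorem supportedMod_thetaOdd (l i : ℤ) :
    SupportedMod 8 1 (thetaOdd l i : LaurentSeries (ZMod 2)) := by
  intro n hn
  rw [PowerSeries.coeff_coe] at hn
  split_ifs at hn with h0
  · exact absurd rfl hn
  · rw [thetaOdd, countSeries, PowerSeries.coeff_mk] at hn
    have hne : {s : ℤ | s ∈ {n : ℤ | n ≡ i [ZMOD l] ∧ Odd n} ∧ s ^ 2 = (n.natAbs : ℤ)}.Nonempty := by
      by_contra h
      rw [Set.not_nonempty_iff_eq_empty] at h
      rw [h, Set.ncard_empty, Nat.cast_zero] at hn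
      exact hn rfl
    obtain ⟨s, ⟨-, hs⟩, hk⟩ := hne
    have hn' : n = s ^ 2 := by omega
    rw [hn']
    exact (Int.modEq_iff_dvd.2 (Int.eight_dvd_sq_sub_one_of_odd hs)).symm

theorem theta_ne_zero {r : ℤ} (hr : ¬ (7 : ℤ) ∣ r) : theta 7 r ≠ 0 := by
  intro h
  have h1 := congrArg (PowerSeries.coeff (r.natAbs ^ 2)) h
  have h2 : {n : ℤ | n ≡ r [ZMOD 7] ∧ n ^ 2 = ((r.natAbs ^ 2 : ℕ) : ℤ)} = {r} := by
    ext n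
    simp only [Set.mem_ofPred_eq, Set.mem_singleton_iff, Nat.cast_pow, Int.natCast_natAbs, sq_abs,
      sq_eq_sq_iff_eq_or_eq_neg, Int.ModEq]
    omega
  rw [theta, PowerSeries.coeff_mk, h2] at h1
  simp at h1

/-- The projections modulo `8` of `1 / a` when `a = b ^ 4 + u` and `b = c ^ 4 + v`, with `u` and `v`
supported in degrees congruent to `1` modulo `8`. -/
theorem proj_inv_of_decomposition {a b c u v : LaurentSeries (ZMod 2)} (ha : a ≠ 0)
    (hau : a = b ^ 4 + u) (hbv : b = c ^ 4 + v) (hu : SupportedMod 8 1 u)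
    (hv : SupportedMod 8 1 v) (habc : a ^ 2 * c ^ 2 = b ^ 4 * c ^ 4 + u * v) :
    proj 8 0 a⁻¹ = b ^ 8 * c ^ 8 ∧ proj 8 2 a⁻¹ = (a ^ 2 + b ^ 8) * c ^ 8 := by
  have two : (2 : LaurentSeries (ZMod 2)) = 0 := by
    rw [← map_ofNat (HahnSeries.C (Γ := ℤ) (R := ZMod 2)) 2,
      show (OfNat.ofNat 2 : ZMod 2) = 0 by rfl, map_zero]
  set h := a⁻¹ ^ 8 with hh
  have hah : a ^ 8 * h = 1 := by rw [hh, ← mul_pow, mul_inv_cancel₀ ha, one_pow]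
  have hh0 : SupportedMod 8 0 h := .pow_eight _
  have hb0 : SupportedMod 8 0 (b ^ 8) := .pow_eight _
  have hc0 : SupportedMod 8 0 (c ^ 16) := by
    rw [show c ^ 16 = (c ^ 2) ^ 8 by ring]
    exact .pow_eight _
  have key : b ^ 16 * c ^ 16 + u ^ 4 * v ^ 4 = a ^ 8 * c ^ 8 := by
    rw [show a ^ 8 * c ^ 8 = (a ^ 2 * c ^ 2) ^ 4 by ring, habc]
    linear_combination (-(2 * (b ^ 4 * c ^ 4) ^ 3 * (u * v) + 3 * (b ^ 4 * c ^ 4) ^ 2 * (u * v) ^ 2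
      + 2 * (b ^ 4 * c ^ 4) * (u * v) ^ 3)) * two
  have hb4 : b ^ 4 = c ^ 16 + v ^ 4 := by
    rw [hbv]
    linear_combination (2 * (c ^ 4) ^ 3 * v + 3 * (c ^ 4) ^ 2 * v ^ 2 + 2 * c ^ 4 * v ^ 3) * two
  have hinv : a⁻¹ = a ^ 7 * h := by
    rw [inv_eq_iff_eq_inv, eq_comm, inv_eq_of_mul_eq_one_left]
    rw [← hah]
    ring
  have expansion : a⁻¹ =
      (b ^ 8) ^ 3 * c ^ 16 * h + b ^ 8 * v ^ 4 * u ^ 4 * h +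
      ((b ^ 8) ^ 2 * c ^ 16 * u ^ 2 * h + v ^ 4 * u ^ 6 * h) +
      ((b ^ 8) ^ 3 * v ^ 4 * h + (b ^ 8) ^ 3 * u * h + (b ^ 8) ^ 2 * v ^ 4 * u ^ 2 * h +
        (b ^ 8) ^ 2 * u ^ 3 * h + b ^ 8 * c ^ 16 * u ^ 4 * h + b ^ 8 * u ^ 5 * h +
        c ^ 16 * u ^ 6 * h + u ^ 7 * h) := by
    have h7 : a ^ 7 = (b ^ 8) ^ 3 * b ^ 4 + (b ^ 8) ^ 3 * u + (b ^ 8) ^ 2 * b ^ 4 * u ^ 2 +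
        (b ^ 8) ^ 2 * u ^ 3 + b ^ 8 * b ^ 4 * u ^ 4 + b ^ 8 * u ^ 5 + b ^ 4 * u ^ 6 + u ^ 7 := by
      rw [hau]
      linear_combination (3 * b ^ 24 * u + 10 * b ^ 20 * u ^ 2 + 17 * b ^ 16 * u ^ 3 +
        17 * b ^ 12 * u ^ 4 + 10 * b ^ 8 * u ^ 5 + 3 * b ^ 4 * u ^ 6) * two
    rw [hinv, h7, hb4]
    ring
  have s1 := ((hb0.pow 3).mul hc0).mul hh0
  have s2 := ((hb0.mul (hv.pow 4)).mul (hu.pow 4)).mul hh0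
  have s3 := (((hb0.pow 2).mul hc0).mul (hu.pow 2)).mul hh0
  have s4 := ((hv.pow 4).mul (hu.pow 6)).mul hh0
  have s5 := ((hb0.pow 3).mul (hv.pow 4)).mul hh0
  have s6 := ((hb0.pow 3).mul hu).mul hh0
  have s7 := (((hb0.pow 2).mul (hv.pow 4)).mul (hu.pow 2)).mul hh0
  have s8 := ((hb0.pow 2).mul (hu.pow 3)).mul hh0
  have s9 := ((hb0.mul hc0).mul (hu.pow 4)).mul hh0
  have s10 := (hb0.mul (hu.pow 5)).mul hh0
  have s11 := (hc0.mul (hu.pow 6)).mul hh0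
  have s12 := (hu.pow 7).mul hh0
  constructor
  · rw [expansion]
    simp only [proj_add]
    rw [s1.proj_eq_self (by decide), s2.proj_eq_self (by decide), s3.proj_eq_zero (by decide),
      s4.proj_eq_zero (by decide), s5.proj_eq_zero (by decide), s6.proj_eq_zero (by decide),
      s7.proj_eq_zero (by decide), s8.proj_eq_zero (by decide), s9.proj_eq_zero (by decide),
      s10.proj_eq_zero (by decide), s11.proj_eq_zero (by decide), s12.proj_eq_zero (by decide)]
    linear_combination b ^ 8 * h * key + b ^ 8 * c ^ 8 * hah
  · rw [expansion]
    simp only [proj_add]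
    rw [s1.proj_eq_zero (by decide), s2.proj_eq_zero (by decide), s3.proj_eq_self (by decide),
      s4.proj_eq_self (by decide), s5.proj_eq_zero (by decide), s6.proj_eq_zero (by decide),
      s7.proj_eq_zero (by decide), s8.proj_eq_zero (by decide), s9.proj_eq_zero (by decide),
      s10.proj_eq_zero (by decide), s11.proj_eq_zero (by decide), s12.proj_eq_zero (by decide)]
    have hu2 : a ^ 2 + b ^ 8 = u ^ 2 := by
      rw [hau]
      linear_combination (b ^ 8 + b ^ 4 * u) * two
    rw [hu2]
    linear_combination u ^ 2 * h * key + u ^ 2 * c ^ 8 * hah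

theorem stmt19 (r : ℤ) (hr : r = 1 ∨ r = 2 ∨ r = 3) :
    proj 8 0 (thetaL 7 r)⁻¹ = thetaL 7 (4 * r) ^ 8 * thetaL 7 (2 * r) ^ 8 ∧
      proj 8 2 (thetaL 7 r)⁻¹ =
        (thetaL 7 r ^ 2 + thetaL 7 (4 * r) ^ 8) * thetaL 7 (2 * r) ^ 8 := by
  have coe {f g : PowerSeries (ZMod 2)} (h : f = g) :
      (f : LaurentSeries (ZMod 2)) = (g : LaurentSeries (ZMod 2)) := congrArg _ h
  refine proj_inv_of_decomposition (u := (thetaOdd 7 r : LaurentSeries (ZMod 2)))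
    (v := (thetaOdd 7 (4 * r) : LaurentSeries (ZMod 2))) ?_ ?_ ?_ (supportedMod_thetaOdd _ _)
    (supportedMod_thetaOdd _ _) ?_
  · rw [thetaL, ne_eq, map_eq_zero_iff _ HahnSeries.ofPowerSeries_injective]
    exact theta_ne_zero (by omega)
  · simpa [thetaL] using coe (theta_eq_pow_four_add_thetaOdd (i := r) (j := 4 * r)
      (by simp only [Int.ModEq]; omega))
  · simpa [thetaL] using coe (theta_eq_pow_four_add_thetaOdd (i := 4 * r) (j := 2 * r)
      (by simp only [Int.ModEq]; omega))
  · simpa [thetaL] using coe (theta_sq_mul_theta_sq r)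
end
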